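/- arXiv:2403.02424 — 2 statements merged into one kernel-verified Lean document; each statement's English description precedes it below -/
import Mathlib

section
/- The quasi-period η₁(τ) of the Weierstrass zeta function for the lattice ℤ + ℤτ equals −(2πi)²·E₂(q)/12, where q = exp(2πiτ) and E₂(q) = 1 − 24·Σ_{n≥1} n·qⁿ/(1−qⁿ). -/
noncomputable section
open Complex

/-- `2πi` as a complex number. -/
def i2pi : ℂ := 2 * (Real.pi : ℂ) * Complex.I

/-- membership in the lattice `ℤ + ℤτ`. -/
def lat (τ z : ℂ) : Prop := ∃ m n : ℤ, z = (m : ℂ) + (n : ℂ) * τ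

/-- the lattice point `m + nτ`. -/
def latPt (τ : ℂ) (p : ℤ × ℤ) : ℂ := (p.1 : ℂ) + (p.2 : ℂ) * τ

/-- The Weierstrass zeta function of the lattice `ℤ + ℤτ`. -/
def wzeta (τ z : ℂ) : ℂ :=
  1 / z + ∑' p : {p : ℤ × ℤ // p ≠ 0},
    (1 / (z - latPt τ p) + 1 / latPt τ p + z / (latPt τ p) ^ 2)

/-- The Weierstrass ℘-function, `℘ = -∂_z ζ`. -/
def wp (τ z : ℂ) : ℂ := - deriv (wzeta τ) z

/-- The quasi-period `η₁(τ) = ζ(z+1,τ) - ζ(z,τ)` (evaluated at `z = -1/2`). -/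
def eta1 (τ : ℂ) : ℂ := wzeta τ (1 / 2) - wzeta τ (-(1 / 2))

/-- The quasi-period `η₂(τ) = ζ(z+τ,τ) - ζ(z,τ)` (evaluated at `z = -τ/2`). -/
def eta2 (τ : ℂ) : ℂ := wzeta τ (τ / 2) - wzeta τ (-(τ / 2))

/-- `ζ₁(z,τ) = (-2πi)⁻¹ (ζ(z,τ) - η₁(τ) z)`. -/
def zeta1 (τ z : ℂ) : ℂ := (-i2pi)⁻¹ * (wzeta τ z - eta1 τ * z)

/-- Normalized Eisenstein series of weight 2. -/
def E2 (q : ℂ) : ℂ := 1 - 24 * ∑' n : ℕ+, ((n : ℕ) : ℂ) * q ^ (n : ℕ) / (1 - q ^ (n : ℕ))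

/-- Normalized Eisenstein series of weight 4. -/
def E4 (q : ℂ) : ℂ := 1 + 240 * ∑' n : ℕ+, ((n : ℕ) : ℂ) ^ 3 * q ^ (n : ℕ) / (1 - q ^ (n : ℕ))

/-- Normalized Eisenstein series of weight 6. -/
def E6 (q : ℂ) : ℂ := 1 - 504 * ∑' n : ℕ+, ((n : ℕ) : ℂ) ^ 5 * q ^ (n : ℕ) / (1 - q ^ (n : ℕ))

/-- `g₂(τ) = (2πi)⁴ E₄(q)/12`. -/
def g2 (τ : ℂ) : ℂ := i2pi ^ 4 * E4 (Complex.exp (i2pi * τ)) / 12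

/-- `g₃(τ) = -(2πi)⁶ E₆(q)/216`. -/
def g3 (τ : ℂ) : ℂ := -(i2pi ^ 6) * E6 (Complex.exp (i2pi * τ)) / 216

section Aux

open EisensteinSeries SummationFilter Filter Topology Asymptotics

/-- summand of the zeta function -/
def zterm (τ z : ℂ) (p : ℤ × ℤ) : ℂ :=
  1 / (z - latPt τ p) + 1 / latPt τ p + z / (latPt τ p) ^ 2

lemma isBigO_half (τ : UpperHalfPlane) (e : ℤ) :
    (fun m : Fin 2 → ℤ => (2 * ((m 0 : ℂ) * τ + m 1) + e)⁻¹) =O[cofinite] (fun m => ‖m‖⁻¹) := by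
  have h := isBigO_linear_add_const_vec τ 0 e
  have hinj : Function.Injective (fun m : Fin 2 → ℤ => (2 : ℤ) • m) := by
    intro a b hab
    ext i
    have := congrFun hab i
    simpa using this
  have h2 := h.comp_tendsto hinj.tendsto_cofinite
  have h3 : ((fun m : Fin 2 → ℤ => ‖m‖⁻¹) ∘ fun m : Fin 2 → ℤ => (2 : ℤ) • m)
      =O[cofinite] (fun m : Fin 2 → ℤ => ‖m‖⁻¹) := by
    refine IsBigO.of_bound 1 (Eventually.of_forall fun m => ?_)
    have : ‖(2 : ℤ) • m‖ = 2 * ‖m‖ := by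
      rw [norm_smul]; simp [Int.norm_eq_abs]
    simp only [Function.comp, this, norm_inv, norm_mul, norm_norm]
    by_cases hm : ‖m‖ = 0
    · simp [hm]
    · have : 0 < ‖m‖ := lt_of_le_of_ne (norm_nonneg _) (Ne.symm hm)
      rw [mul_inv, one_mul]
      have : 0 < ‖m‖⁻¹ := by positivity
      norm_num
      linarith
  refine (h2.trans h3).congr_left fun m => ?_
  simp only [Function.comp, Pi.smul_apply, smul_eq_mul]
  push_cast
  congr 1
  ring

lemma two_lat_ne (τ : UpperHalfPlane) (a b e : ℤ) (he : Odd e) :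
    2 * ((a : ℂ) * τ + b) + e ≠ 0 := by
  intro h
  have h1 := congrArg Complex.im h
  have hτ : (τ : ℂ).im ≠ 0 := τ.im_ne_zero
  have ha : a = 0 := by
    simp at h1
    exact h1.resolve_right τ.im_ne_zero
  subst ha
  have : ((2 * b + e : ℤ) : ℂ) = 0 := by
    rw [← h]; push_cast; ring
  have h2 : 2 * b + e = 0 := by exact_mod_cast this
  obtain ⟨k, rfl⟩ := he
  omega

lemma lat_ne (τ : UpperHalfPlane) (a b : ℤ) (h0 : (a, b) ≠ (0, 0)) :
    ((a : ℂ) * τ + b) ≠ 0 := by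
  intro h
  have h1 := congrArg Complex.im h
  have hτ : (τ : ℂ).im ≠ 0 := τ.im_ne_zero
  have ha : a = 0 := by
    simp at h1
    exact h1.resolve_right τ.im_ne_zero
  subst ha
  apply h0
  simpa using h

lemma summable_zterm (τ : UpperHalfPlane) (e : ℤ) (he : e = 1 ∨ e = -1) :
    Summable (zterm τ (e / 2)) := by
  have H : Summable fun m : Fin 2 → ℤ => zterm τ (e / 2) (m 1, m 0) := by
    have H0 : Summable fun m : Fin 2 → ℤ =>
        ((2 * ((m 0 : ℂ) * τ + m 1) + (-e : ℤ))⁻¹ * ((m 0 : ℂ) * τ + m 1)⁻¹ *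
          ((m 0 : ℂ) * τ + m 1)⁻¹) * (-1 / 2) := by
      refine Summable.mul_right _ ?_
      apply summable_of_isBigO_rpow_norm (a := 3) (by linarith)
      have h0 := isBigO_linear_add_const_vec τ 0 0
      simp only [Int.cast_zero, add_zero] at h0
      refine (((isBigO_half τ (-e)).mul h0).mul h0).congr_right fun m => ?_
      rw [show (3 : ℝ) = ((3 : ℕ) : ℝ) by norm_num, Real.rpow_natCast]
      ring
    refine H0.congr_cofinite ?_
    have : ∀ᶠ m : Fin 2 → ℤ in cofinite, m ≠ 0 := by
      simp [eventually_cofinite]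
    filter_upwards [this] with m hm
    have hw : ((m 0 : ℂ) * τ + m 1) ≠ 0 := by
      apply lat_ne
      intro h
      apply hm
      simp only [Prod.mk.injEq] at h
      ext i
      fin_cases i
      · exact h.1
      · exact h.2
    have hw2 := two_lat_ne τ (m 0) (m 1) (-e) (by rcases he with rfl | rfl <;> decide)
    simp only [zterm, latPt]
    rw [show (m 1 : ℂ) + (m 0 : ℂ) * τ = (m 0 : ℂ) * τ + m 1 by ring]
    generalize (m 0 : ℂ) * τ + m 1 = w at *
    have he2 : (e : ℂ) ^ 2 = 1 := by rcases he with rfl | rfl <;> norm_num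
    push_cast at hw2 ⊢
    have h3 : (e : ℂ) / 2 - w ≠ 0 := by
      intro h; apply hw2; linear_combination -2 * h
    have h4 : (2 * w + -(e : ℂ)) = -2 * ((e : ℂ) / 2 - w) := by ring
    rw [h4]
    generalize hu : (e : ℂ) / 2 - w = u at *
    have h5 : (e : ℂ) = 2 * (u + w) := by rw [← hu]; ring
    rw [h5] at he2 ⊢
    field_simp
    linear_combination (-1 : ℂ) * he2
  rw [← ((finTwoArrowEquiv ℤ).trans (Equiv.prodComm ℤ ℤ)).summable_iff]
  exact H

lemma wzeta_eq (τ z : ℂ) (h : Summable (zterm τ z)) : wzeta τ z = ∑' p, zterm τ z p := by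
  have := h.sum_add_tsum_subtype_compl {0}
  rw [← this, wzeta]
  congr 1
  · simp [zterm, latPt]
  · rw [← (Equiv.subtypeEquivRight (p := fun p : ℤ × ℤ => p ≠ 0)
      (q := fun p => p ∉ ({0} : Finset (ℤ × ℤ))) (by simp)).tsum_eq]
    rfl

lemma tele (τ : UpperHalfPlane) (n : ℤ)
    (hs : Summable fun m : ℤ => 1 / ((n : ℂ) * τ + m + 1 / 2) - 1 / ((n : ℂ) * τ + m - 1 / 2)) :
    ∑' m : ℤ, (1 / ((n : ℂ) * τ + m + 1 / 2) - 1 / ((n : ℂ) * τ + m - 1 / 2)) = 0 := by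
  have h2 : Tendsto (fun N : ℕ => ∑ m ∈ Finset.Ico (-N : ℤ) N,
      (1 / ((n : ℂ) * τ + m + 1 / 2) - 1 / ((n : ℂ) * τ + m - 1 / 2))) atTop (𝓝 0) := by
    have h3 : ∀ N : ℕ, ∑ m ∈ Finset.Ico (-N : ℤ) N,
        (1 / ((n : ℂ) * τ + m + 1 / 2) - 1 / ((n : ℂ) * τ + m - 1 / 2)) =
        1 / (((1 : ℤ) : ℂ) * (n * τ - 1 / 2) + N) - 1 / (((1 : ℤ) : ℂ) * (n * τ - 1 / 2) - N) := by
      intro N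
      have := Finset.sum_Ico_int_sub N (fun m : ℤ => 1 / ((n : ℂ) * τ + m - 1 / 2))
      rw [← neg_inj, ← Finset.sum_neg_distrib]
      convert this using 1
      · refine Finset.sum_congr rfl fun m _ => ?_
        push_cast; ring_nf
      · push_cast; ring_nf
    simp_rw [h3]
    simpa using (tendsto_zero_inv_linear ((n : ℂ) * τ - 1 / 2) 1).sub
      (tendsto_zero_inv_linear_sub ((n : ℂ) * τ - 1 / 2) 1)
  rw [← tsum_eq_of_summable_unconditional (L := symmetricIco ℤ) hs]
  apply HasSum.tsum_eq
  rw [hasSum_symmetricIco_int_iff]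
  exact h2

lemma eta1_eq_G2 (τ : UpperHalfPlane) : eta1 τ = G2 τ := by
  have s1 := summable_zterm τ 1 (Or.inl rfl)
  have s2 := summable_zterm τ (-1) (Or.inr rfl)
  push_cast at s1 s2
  rw [show (-1 : ℂ) / 2 = -(1 / 2) by ring] at s2
  have s3 := (Equiv.prodComm ℤ ℤ).summable_iff.mpr (s1.sub s2)
  have key : ∀ n : ℤ, ∑' m : ℤ, ((fun b => zterm τ (1 / 2) b - zterm τ (-(1 / 2)) b) ∘
      Equiv.prodComm ℤ ℤ) (n, m) = e2Summand n τ := by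
    intro n
    have s4 := s3.prod_factor n
    have e : ∀ m : ℤ, ((fun b => zterm τ (1 / 2) b - zterm τ (-(1 / 2)) b) ∘
      Equiv.prodComm ℤ ℤ) (n, m) = (1 / ((n : ℂ) * τ + m + 1 / 2) -
        1 / ((n : ℂ) * τ + m - 1 / 2)) + eisSummand 2 ![n, m] τ := by
      intro m
      simp only [Function.comp, Equiv.prodComm_apply, Prod.swap, zterm, latPt, eisSummand,
        Matrix.cons_val_zero, Matrix.cons_val_one, Matrix.cons_val_fin_one]
      rw [show (m : ℂ) + (n : ℂ) * τ = (n : ℂ) * τ + m by ring]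
      generalize (n : ℂ) * τ + m = w
      rw [show (1 / 2 : ℂ) - w = -(w - 1 / 2) by ring, show -(1 / 2 : ℂ) - w = -(w + 1 / 2) by ring]
      rw [zpow_neg, zpow_ofNat, one_div_neg_eq_neg_one_div, one_div_neg_eq_neg_one_div]
      ring
    have s5 := e2Summand_summable n τ
    have s6 : Summable fun m : ℤ => 1 / ((n : ℂ) * τ + m + 1 / 2) -
        1 / ((n : ℂ) * τ + m - 1 / 2) := by
      refine (s4.sub s5).congr fun m => ?_
      rw [e m]; ring
    rw [tsum_congr e, s6.tsum_add s5, tele τ n s6, zero_add, e2Summand]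
  rw [eta1, wzeta_eq _ _ s1, wzeta_eq _ _ s2, ← s1.tsum_sub s2, ← (Equiv.prodComm ℤ ℤ).tsum_eq]
  have s7 := s3.prod
  have := s3.tsum_prod
  simp only [key] at this s7
  rw [G2, tsum_eq_of_summable_unconditional s7, ← this]
  rfl

end Aux

/-- `η₁(τ) = -(2πi)² E₂(q)/12` with `q = exp(2πiτ)`. -/
theorem eta1_eq_E2 (τ : ℂ) (hτ : 0 < τ.im) :
    eta1 τ = -(i2pi ^ 2) * E2 (Complex.exp (i2pi * τ)) / 12 := by
  have h := eta1_eq_G2 ⟨τ, hτ⟩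
  have hq := UpperHalfPlane.norm_exp_two_pi_I_lt_one ⟨τ, hτ⟩
  rw [EisensteinSeries.G2_eq_tsum_cexp, riemannZeta_two, ← tsum_pow_div_one_sub_eq_tsum_sigma hq] at h
  simp only [pow_one] at h
  change eta1 τ = _ at h
  rw [h]
  simp only [E2, i2pi]
  simp only [mul_pow, Complex.I_sq]
  ring
end
end

section
/- One has the heat-type identity ∂_τζ₁(z,τ) + ζ₁(z,τ)·∂_zζ₁(z,τ) = (2πi)^{-2}·(1/2)·℘'(z,τ), where ζ₁(z,τ) = (−2πi)^{-1}(ζ(z,τ) − η₁(τ)z). -/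
noncomputable section
open Complex

open Filter Topology Metric

/-- `π cot (π w)`. -/
def gc (w : ℂ) : ℂ := Real.pi * Complex.cot (Real.pi * w)

/-- the derivative of `π cot (π w)`. -/
def gd (w : ℂ) : ℂ := -((Real.pi : ℂ) ^ 2 + gc w ^ 2)

/-- not a pole -/
def np (w : ℂ) : Prop := Complex.sin (Real.pi * w) ≠ 0

lemma gc_neg (w : ℂ) : gc (-w) = -gc w := by
  simp [gc, Complex.cot, div_neg]

lemma gd_neg (w : ℂ) : gd (-w) = gd w := by
  simp [gd, gc_neg]

lemma gc_zero : gc 0 = 0 := by simp [gc, Complex.cot]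

lemma gc_add_one (w : ℂ) : gc (w + 1) = gc w := by
  simp only [gc, Complex.cot, mul_add, mul_one, Complex.cos_add_pi, Complex.sin_add_pi]
  simp

lemma gd_add_one (w : ℂ) : gd (w + 1) = gd w := by
  simp [gd, gc_add_one]

lemma np_iff (w : ℂ) : np w ↔ ∀ k : ℤ, w ≠ k := by
  have hpi : (Real.pi : ℂ) ≠ 0 := by exact_mod_cast Real.pi_ne_zero
  rw [np, Complex.sin_ne_zero_iff]
  refine forall_congr' fun k => not_congr ?_
  rw [mul_comm (k : ℂ)]
  exact mul_right_inj' hpi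

lemma gc_hasDerivAt {w : ℂ} (h : np w) : HasDerivAt gc (gd w) w := by
  have hs : HasDerivAt (fun w : ℂ => Complex.sin (Real.pi * w)) (Complex.cos (Real.pi * w) * (Real.pi * 1)) w :=
    (Complex.hasDerivAt_sin _).comp w ((hasDerivAt_id w).const_mul _)
  have hc : HasDerivAt (fun w : ℂ => Complex.cos (Real.pi * w)) (-Complex.sin (Real.pi * w) * (Real.pi * 1)) w :=
    (Complex.hasDerivAt_cos _).comp w ((hasDerivAt_id w).const_mul _)
  have := (hc.div hs h).const_mul (Real.pi : ℂ)
  refine this.congr_deriv ?_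
  simp only [gd, gc, Complex.cot]
  have h' : Complex.sin (Real.pi * w) ≠ 0 := h
  field_simp
  ring

lemma gd_hasDerivAt {w : ℂ} (h : np w) : HasDerivAt gd (-2 * gc w * gd w) w := by
  have := ((gc_hasDerivAt h).pow 2).const_add ((Real.pi : ℂ) ^ 2) |>.neg
  refine this.congr_deriv ?_
  push_cast
  ring

lemma gc_exp (w : ℂ) (h : Complex.exp (2 * Real.pi * Complex.I * w) ≠ 1) :
    gc w + Real.pi * I = 2 * Real.pi * I * (Complex.exp (2 * Real.pi * Complex.I * w) /
      (Complex.exp (2 * Real.pi * Complex.I * w) - 1)) := by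
  rw [gc, Complex.cot_pi_eq_exp_ratio]
  have h1 : Complex.exp (2 * Real.pi * Complex.I * w) - 1 ≠ 0 := sub_ne_zero.2 h
  have h2 : 1 - Complex.exp (2 * Real.pi * Complex.I * w) ≠ 0 := sub_ne_zero.2 h.symm
  generalize Complex.exp (2 * Real.pi * Complex.I * w) = E at *
  have hI : I ≠ 0 := I_ne_zero
  field_simp
  have : I ^ 2 = -1 := I_sq
  rw [this]
  ring

lemma exp_neg_two_pi_le {y : ℝ} (hy : 1 ≤ y) : Real.exp (-(2 * Real.pi * y)) ≤ 1 / 2 := by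
  have h1 : Real.exp (-(2 * Real.pi * y)) ≤ Real.exp (-1) := by
    apply Real.exp_le_exp.2
    nlinarith [Real.pi_gt_three]
  have h2 := Real.exp_neg_one_lt_half
  linarith

lemma gc_bound {w : ℂ} (hy : 1 ≤ w.im) :
    ‖gc w + Real.pi * I‖ ≤ 4 * Real.pi * Real.exp (-(2 * Real.pi * w.im)) := by
  have hE : ‖Complex.exp (2 * Real.pi * Complex.I * w)‖ = Real.exp (-(2 * Real.pi * w.im)) := by
    rw [Complex.norm_exp]; simp
  have hle := exp_neg_two_pi_le hy
  rw [gc_exp]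
  · rw [norm_mul, norm_div, hE]
    have h1 : 1 / 2 ≤ ‖Complex.exp (2 * Real.pi * Complex.I * w) - 1‖ := by
      have := norm_sub_norm_le (1 : ℂ) (Complex.exp (2 * Real.pi * Complex.I * w))
      rw [norm_sub_rev, hE, norm_one] at this
      linarith
    have h2 : ‖(2 * Real.pi * I : ℂ)‖ = 2 * Real.pi := by
      simp [abs_of_pos Real.pi_pos]
    rw [h2]
    have : Real.exp (-(2 * Real.pi * w.im)) / ‖Complex.exp (2 * Real.pi * Complex.I * w) - 1‖ ≤
        Real.exp (-(2 * Real.pi * w.im)) / (1 / 2) := by gcongr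
    calc _ ≤ 2 * Real.pi * (Real.exp (-(2 * Real.pi * w.im)) / (1 / 2)) := by gcongr
      _ = _ := by ring
  · intro h
    rw [h, norm_one] at hE
    linarith

lemma gd_bound {w : ℂ} (hy : 1 ≤ w.im) :
    ‖gd w‖ ≤ 24 * Real.pi ^ 2 * Real.exp (-(2 * Real.pi * w.im)) := by
  have h1 := gc_bound hy
  have hle := exp_neg_two_pi_le hy
  have h2 : ‖gc w - Real.pi * I‖ ≤ 6 * Real.pi := by
    have e : gc w - Real.pi * I = (gc w + Real.pi * I) - 2 * Real.pi * I := by ring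
    have h2 : ‖(2 * Real.pi * I : ℂ)‖ = 2 * Real.pi := by
      simp [abs_of_pos Real.pi_pos]
    rw [e]
    refine (norm_sub_le _ _).trans ?_
    rw [h2]
    nlinarith [Real.pi_pos]
  have e : gd w = -((gc w + Real.pi * I) * (gc w - Real.pi * I)) := by
    rw [gd]
    linear_combination (-(Real.pi : ℂ) ^ 2) * I_sq
  rw [e, norm_neg, norm_mul]
  calc _ ≤ (4 * Real.pi * Real.exp (-(2 * Real.pi * w.im))) * (6 * Real.pi) := by gcongr
    _ = _ := by ring

lemma np_of_im {w : ℂ} (h : w.im ≠ 0) : np w := by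
  rw [np_iff]
  rintro k rfl
  simp at h

/-- the terms of the series -/
def fn (t z : ℂ) (n : ℤ) : ℂ := gc (z - n * t) - Real.pi * I * (n.sign : ℂ)

lemma term_bound {c : ℝ} (w : ℂ) (n : ℤ) (hn : n ≠ 0) (hc : 0 < c)
    (h1 : 0 < n → w.im ≤ -(n * c) - 1) (h2 : n < 0 → -n * c + 1 ≤ w.im) :
    np w ∧ ‖gc w - Real.pi * I * (n.sign : ℂ)‖ ≤ 24 * Real.pi ^ 2 * Real.exp (-(2 * Real.pi * c)) ^ n.natAbs ∧
    ‖gd w‖ ≤ 24 * Real.pi ^ 2 * Real.exp (-(2 * Real.pi * c)) ^ n.natAbs := by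
  have key : ∀ (v : ℂ), (n.natAbs : ℝ) * c + 1 ≤ v.im →
      np v ∧ ‖gc v + Real.pi * I‖ ≤ 24 * Real.pi ^ 2 * Real.exp (-(2 * Real.pi * c)) ^ n.natAbs ∧
      ‖gd v‖ ≤ 24 * Real.pi ^ 2 * Real.exp (-(2 * Real.pi * c)) ^ n.natAbs := by
    intro v hv
    have h0 : 0 ≤ (n.natAbs : ℝ) * c := by positivity
    have hy : 1 ≤ v.im := by linarith
    have he : Real.exp (-(2 * Real.pi * v.im)) ≤ Real.exp (-(2 * Real.pi * c)) ^ n.natAbs := by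
      rw [← Real.exp_nat_mul]
      apply Real.exp_le_exp.2
      nlinarith [Real.pi_pos]
    have hp := Real.pi_gt_three
    refine ⟨np_of_im (by linarith), (gc_bound hy).trans ?_, (gd_bound hy).trans ?_⟩
    · have : 4 * Real.pi ≤ 24 * Real.pi ^ 2 := by nlinarith
      gcongr
    · gcongr
  rcases lt_or_gt_of_ne hn with h | h
  · have hna : (n.natAbs : ℝ) = -n := by
      rw [← Int.cast_natCast, Int.ofNat_natAbs_of_nonpos h.le]; simp
    have := key w (by rw [hna]; exact h2 h)
    rw [Int.sign_eq_neg_one_of_neg h]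
    simpa using this
  · have hna : (n.natAbs : ℝ) = n := by
      rw [← Int.cast_natCast, Int.natAbs_of_nonneg h.le]
    have := key (-w) (by rw [hna]; have := h1 h; simp; linarith)
    rw [Int.sign_eq_one_of_pos h]
    rw [gd_neg, gc_neg] at this
    refine ⟨?_, ?_, this.2.2⟩
    · have h3 := this.1
      simpa [np] using h3
    · have h3 := this.2.1
      rw [← norm_neg]
      have e : -(gc w - Real.pi * I * ((1 : ℤ) : ℂ)) = -gc w + Real.pi * I := by
        push_cast; ring
      rw [e]; exact h3

lemma key_bound (a : ℤ → ℂ) (ha1 : ∀ n, ‖a n‖ ≤ 1) (τ z : ℂ) (hτ : 0 < τ.im)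
    (ha : ∀ n, a n ≠ 0 → np (z - n * τ)) :
    ∃ ε > 0, ∃ u : ℤ → ℝ, Summable u ∧ ∀ t ∈ ball τ ε, 0 < t.im ∧ ∀ w ∈ ball z ε, ∀ n : ℤ,
      (a n ≠ 0 → np (w - n * t)) ∧ ‖a n * fn t w n‖ ≤ u n ∧
      (1 + |(n : ℝ)|) * ‖a n * gd (w - n * t)‖ ≤ u n := by
  set c := τ.im / 2 with hc
  have hcp : 0 < c := by positivity
  obtain ⟨N, hN⟩ := exists_nat_gt ((|z.im| + 2) / (τ.im / 4))
  rw [div_lt_iff₀ (by positivity)] at hN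
  set ρ := Real.exp (-(2 * Real.pi * c)) with hρ
  have hρ1 : ρ < 1 := by
    rw [hρ, Real.exp_lt_one_iff]
    have := Real.pi_pos
    have : 0 < 2 * Real.pi * c := by positivity
    linarith
  have hρ0 : 0 < ρ := Real.exp_pos _
  set C := 24 * Real.pi ^ 2 with hC
  have hC0 : 0 < C := by have := Real.pi_pos; positivity
  -- finitely many terms
  have hev : ∀ n : ℤ, ∃ B : ℝ, 0 ≤ B ∧ ∀ᶠ p : ℂ × ℂ in 𝓝 (τ, z),
      (a n ≠ 0 → np (p.2 - n * p.1)) ∧ ‖a n * fn p.1 p.2 n‖ ≤ B ∧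
      (1 + |(n : ℝ)|) * ‖a n * gd (p.2 - n * p.1)‖ ≤ B := by
    intro n
    by_cases h0 : a n = 0
    · refine ⟨0, le_rfl, ?_⟩
      simp [h0]
    · have hnp := ha n h0
      have hmap : ContinuousAt (fun p : ℂ × ℂ => p.2 - n * p.1) (τ, z) := by fun_prop
      have hs : ∀ᶠ p : ℂ × ℂ in 𝓝 (τ, z), np (p.2 - n * p.1) := by
        have : ContinuousAt (fun p : ℂ × ℂ => Complex.sin (Real.pi * (p.2 - n * p.1))) (τ, z) := by
          fun_prop
        exact this.eventually_ne hnp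
      have c1 : ContinuousAt (fun p : ℂ × ℂ => gc (p.2 - n * p.1)) (τ, z) :=
        ContinuousAt.comp (g := gc) (f := fun p : ℂ × ℂ => p.2 - n * p.1) (gc_hasDerivAt hnp).continuousAt hmap
      have c2 : ContinuousAt (fun p : ℂ × ℂ => gd (p.2 - n * p.1)) (τ, z) :=
        ContinuousAt.comp (g := gd) (f := fun p : ℂ × ℂ => p.2 - n * p.1) (gd_hasDerivAt hnp).continuousAt hmap
      have c1' : ContinuousAt (fun p : ℂ × ℂ => ‖a n * fn p.1 p.2 n‖) (τ, z) := by
        unfold fn; fun_prop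
      have c2' : ContinuousAt (fun p : ℂ × ℂ => (1 + |(n : ℝ)|) * ‖a n * gd (p.2 - n * p.1)‖) (τ, z) := by
        fun_prop
      set B1 := ‖a n * fn τ z n‖ with hB1
      set B2 := (1 + |(n : ℝ)|) * ‖a n * gd (z - n * τ)‖ with hB2
      have p1 : 0 ≤ B1 := norm_nonneg _
      have p2 : 0 ≤ B2 := by positivity
      refine ⟨B1 + B2 + 1, by positivity, ?_⟩
      have e1 := c1'.eventually (Iio_mem_nhds (show ‖a n * fn τ z n‖ < B1 + B2 + 1 by linarith))
      have e2 := c2'.eventually (Iio_mem_nhds (show (1 + |(n : ℝ)|) * ‖a n * gd (z - n * τ)‖ < B1 + B2 + 1 by linarith))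
      filter_upwards [hs, e1, e2] with p q1 q2 q3
      exact ⟨fun _ => q1, le_of_lt q2, le_of_lt q3⟩
  choose B hB0 hB using hev
  have hall : ∀ᶠ p : ℂ × ℂ in 𝓝 (τ, z), ∀ n ∈ Finset.Ioo (-(N : ℤ)) N,
      (a n ≠ 0 → np (p.2 - n * p.1)) ∧ ‖a n * fn p.1 p.2 n‖ ≤ B n ∧
      (1 + |(n : ℝ)|) * ‖a n * gd (p.2 - n * p.1)‖ ≤ B n :=
    (Filter.eventually_all_finset _).2 fun n _ => hB n
  obtain ⟨ε, hε, hball⟩ := Metric.eventually_nhds_iff_ball.1 hall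
  set u1 : ℤ → ℝ := fun n => (1 + (n.natAbs : ℝ)) * (C * ρ ^ n.natAbs) with hu1
  set u2 : ℤ → ℝ := fun n => if n ∈ Finset.Ioo (-(N : ℤ)) N then B n else 0 with hu2
  have su1 : Summable u1 := by
    have sn : Summable (fun k : ℕ => (1 + (k : ℝ)) * (C * ρ ^ k)) := by
      have s1 := summable_geometric_of_lt_one hρ0.le hρ1
      have s2 := summable_pow_mul_geometric_of_norm_lt_one 1 (r := ρ) (by rwa [Real.norm_of_nonneg hρ0.le])
      refine ((s1.add s2).mul_left C).congr fun k => ?_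
      ring
    apply Summable.of_nat_of_neg <;> simpa [hu1] using sn
  have su2 : Summable u2 := by
    apply summable_of_ne_finset_zero (s := Finset.Ioo (-(N : ℤ)) N)
    intro n hn
    simp only [hu2, if_neg hn]
  refine ⟨min ε (min 1 (τ.im / 4)), by positivity, fun n => u1 n + u2 n, su1.add su2, ?_⟩
  intro t ht
  rw [mem_ball, lt_min_iff, lt_min_iff] at ht
  have him : |t.im - τ.im| < τ.im / 4 := by
    refine lt_of_le_of_lt ?_ ht.2.2
    rw [dist_eq_norm, ← Complex.sub_im]
    exact Complex.abs_im_le_norm _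
  rw [abs_lt] at him
  refine ⟨by linarith, fun w hw n => ?_⟩
  rw [mem_ball, lt_min_iff, lt_min_iff] at hw
  have hwm : |w.im - z.im| < 1 := by
    refine lt_of_le_of_lt ?_ hw.2.1
    rw [dist_eq_norm, ← Complex.sub_im]
    exact Complex.abs_im_le_norm _
  rw [abs_lt] at hwm
  have u1n : 0 ≤ u1 n := by positivity
  have u2n : 0 ≤ u2 n := by
    simp only [hu2]; split_ifs
    · exact hB0 n
    · exact le_rfl
  by_cases hn : n ∈ Finset.Ioo (-(N : ℤ)) N
  · have := hball (t, w) (by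
      rw [mem_ball, Prod.dist_eq]; exact max_lt ht.1 hw.1) n hn
    have e : u2 n = B n := by simp only [hu2, if_pos hn]
    refine ⟨this.1, ?_, ?_⟩
    · linarith [this.2.1]
    · linarith [this.2.2]
  · have hN0 : (0 : ℝ) < N := by
      have : 0 ≤ |z.im| := abs_nonneg _
      by_contra hneg
      nlinarith
    have hN0' : 0 < (N : ℤ) := by exact_mod_cast hN0
    have hz1 := le_abs_self z.im
    have hz2 := neg_abs_le z.im
    have hn0 : n ≠ 0 := by
      rintro rfl
      apply hn; simp; exact_mod_cast hN0
    have hwim : (w - n * t).im = w.im - n * t.im := by simp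
    have tb := term_bound (c := c) (w - n * t) n hn0 hcp (by
        intro hpos
        have : (N : ℤ) ≤ n := by
          by_contra hlt
          apply hn; rw [Finset.mem_Ioo]; constructor <;> linarith
        have hnr : (N : ℝ) ≤ n := by exact_mod_cast this
        rw [hwim]
        nlinarith) (by
        intro hneg
        have : n ≤ -(N : ℤ) := by
          by_contra hlt
          apply hn; rw [Finset.mem_Ioo]; constructor <;> linarith
        have hnr : (n : ℝ) ≤ -N := by exact_mod_cast this
        rw [hwim]
        nlinarith)
    have hnn : |(n : ℝ)| = n.natAbs := by
      rw [← Int.cast_abs, Int.abs_eq_natAbs]; simp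
    refine ⟨fun _ => tb.1, ?_, ?_⟩
    · calc ‖a n * fn t w n‖ ≤ 1 * (C * ρ ^ n.natAbs) := by
            rw [norm_mul]; gcongr
            · exact ha1 n
            · exact tb.2.1
        _ ≤ (1 + (n.natAbs : ℝ)) * (C * ρ ^ n.natAbs) := by
            gcongr; simp
        _ ≤ u1 n + u2 n := by linarith
    · calc (1 + |(n : ℝ)|) * ‖a n * gd (w - n * t)‖ ≤ (1 + (n.natAbs : ℝ)) * (1 * (C * ρ ^ n.natAbs)) := by
            rw [norm_mul, hnn]; gcongr
            · exact ha1 n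
            · exact tb.2.2
        _ = u1 n := by rw [one_mul]
        _ ≤ u1 n + u2 n := by linarith

/-- weighted series -/
def Lw (a : ℤ → ℂ) (t z : ℂ) : ℂ := ∑' n : ℤ, a n * fn t z n
/-- its `z`-derivative -/
def Dw (a : ℤ → ℂ) (t z : ℂ) : ℂ := ∑' n : ℤ, a n * gd (z - n * t)
/-- its `τ`-derivative -/
def Tw (a : ℤ → ℂ) (t z : ℂ) : ℂ := ∑' n : ℤ, -((n : ℂ) * (a n * gd (z - n * t)))

/-- admissible weights and points -/
structure Adm (a : ℤ → ℂ) (τ z : ℂ) : Prop where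
  im : 0 < τ.im
  le : ∀ n, ‖a n‖ ≤ 1
  np : ∀ n : ℤ, a n ≠ 0 → np (z - n * τ)

lemma bd1 {n : ℤ} {x : ℂ} {u : ℝ} (h : (1 + |(n : ℝ)|) * ‖x‖ ≤ u) : ‖x‖ ≤ u := by
  refine le_trans ?_ h
  nlinarith [abs_nonneg (n : ℝ), norm_nonneg x, mul_nonneg (abs_nonneg (n : ℝ)) (norm_nonneg x)]

lemma bd2 {n : ℤ} {x : ℂ} {u : ℝ} (h : (1 + |(n : ℝ)|) * ‖x‖ ≤ u) : ‖-((n : ℂ) * x)‖ ≤ u := by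
  refine le_trans ?_ h
  rw [norm_neg, norm_mul, Complex.norm_intCast]
  nlinarith [abs_nonneg (n : ℝ), norm_nonneg x, mul_nonneg (abs_nonneg (n : ℝ)) (norm_nonneg x)]

lemma Adm.facts {a : ℤ → ℂ} {τ z : ℂ} (h : Adm a τ z) :
    Summable (fun n : ℤ => a n * fn τ z n) ∧
    Summable (fun n : ℤ => a n * gd (z - n * τ)) ∧
    Summable (fun n : ℤ => -((n : ℂ) * (a n * gd (z - n * τ)))) ∧
    HasDerivAt (Lw a τ) (Dw a τ z) z ∧
    DifferentiableAt ℂ (Dw a τ) z ∧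
    DifferentiableAt ℂ (Tw a τ) z ∧
    HasDerivAt (fun t => Lw a t z) (Tw a τ z) τ ∧
    (∀ᶠ t in 𝓝 τ, Adm a t z) ∧ (∀ᶠ w in 𝓝 z, Adm a τ w) := by
  obtain ⟨ε, hε, u, hu, H⟩ := key_bound a h.le τ z h.im h.np
  have hτ : τ ∈ ball τ ε := mem_ball_self hε
  have hz : z ∈ ball z ε := mem_ball_self hε
  have s1 : Summable (fun n : ℤ => a n * fn τ z n) :=
    Summable.of_norm_bounded hu fun n => ((H τ hτ).2 z hz n).2.1
  refine ⟨s1, Summable.of_norm_bounded hu fun n => bd1 ((H τ hτ).2 z hz n).2.2,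
    Summable.of_norm_bounded hu fun n => bd2 ((H τ hτ).2 z hz n).2.2, ?_, ?_, ?_, ?_, ?_, ?_⟩
  · refine hasDerivAt_tsum_of_isPreconnected hu isOpen_ball (convex_ball z ε).isPreconnected
      (g := fun n w => a n * fn τ w n) (g' := fun n w => a n * gd (w - n * τ)) ?_ ?_ hz s1 hz
    · intro n w hw
      by_cases h0 : a n = 0
      · simpa [h0] using hasDerivAt_const w (0 : ℂ)
      · have := (gc_hasDerivAt (((H τ hτ).2 w hw n).1 h0)).comp_sub_const w (n * τ)
        exact (this.sub_const _).const_mul (a n)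
    · intro n w hw
      exact bd1 ((H τ hτ).2 w hw n).2.2
  · have := differentiableOn_tsum_of_summable_norm (F := fun (n : ℤ) w => a n * gd (w - n * τ)) hu
      (U := ball z ε) (fun n w hw => by
        by_cases h0 : a n = 0
        · simp only [h0, zero_mul]; exact differentiableWithinAt_const _
        · have := (gd_hasDerivAt (((H τ hτ).2 w hw n).1 h0)).comp_sub_const w (n * τ)
          exact (this.const_mul (a n)).differentiableAt.differentiableWithinAt) isOpen_ball
      (fun n w hw => bd1 ((H τ hτ).2 w hw n).2.2)
    exact this.differentiableAt (isOpen_ball.mem_nhds hz)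
  · have := differentiableOn_tsum_of_summable_norm
      (F := fun (n : ℤ) w => -((n : ℂ) * (a n * gd (w - n * τ)))) hu
      (U := ball z ε) (fun n w hw => by
        by_cases h0 : a n = 0
        · simp only [h0, zero_mul, mul_zero]; exact differentiableWithinAt_const _
        · have := (gd_hasDerivAt (((H τ hτ).2 w hw n).1 h0)).comp_sub_const w (n * τ)
          exact ((this.const_mul (a n)).const_mul (n : ℂ)).neg.differentiableAt.differentiableWithinAt) isOpen_ball
      (fun n w hw => bd2 ((H τ hτ).2 w hw n).2.2)
    exact this.differentiableAt (isOpen_ball.mem_nhds hz)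
  · refine hasDerivAt_tsum_of_isPreconnected hu isOpen_ball (convex_ball τ ε).isPreconnected
      (g := fun n t => a n * fn t z n)
      (g' := fun n t => -((n : ℂ) * (a n * gd (z - n * t)))) ?_ ?_ hτ s1 hτ
    · intro n t ht
      by_cases h0 : a n = 0
      · simpa [h0] using hasDerivAt_const t (0 : ℂ)
      · have h1 : HasDerivAt (fun t : ℂ => z - n * t) (-((n : ℂ) * 1)) t :=
          ((hasDerivAt_id t).const_mul (n : ℂ)).const_sub z
        have := (gc_hasDerivAt (((H t ht).2 z hz n).1 h0)).comp t h1
        refine ((this.sub_const (Real.pi * I * (n.sign : ℂ))).const_mul (a n)).congr_deriv ?_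
        ring
    · intro n t ht
      exact bd2 ((H t ht).2 z hz n).2.2
  · filter_upwards [ball_mem_nhds τ hε] with t ht
    exact ⟨(H t ht).1, h.le, fun n => ((H t ht).2 z hz n).1⟩
  · filter_upwards [ball_mem_nhds z hε] with w hw
    exact ⟨h.im, h.le, fun n => ((H τ hτ).2 w hw n).1⟩

/-- all weights `1` -/
def one' : ℤ → ℂ := fun _ => 1
/-- drop `n = 0` -/
def omz : ℤ → ℂ := fun n => if n = 0 then 0 else 1

lemma adm_one_iff {τ z : ℂ} (hτ : 0 < τ.im) : Adm one' τ z ↔ ¬ lat τ z := by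
  constructor
  · rintro h ⟨m, n, rfl⟩
    have := h.np n one_ne_zero
    rw [np_iff] at this
    exact this m (by ring)
  · intro h
    refine ⟨hτ, fun n => by simp [one'], fun n _ => ?_⟩
    rw [np_iff]
    intro k hk
    exact h ⟨k, n, by linear_combination hk⟩

lemma lat_neg {τ z : ℂ} (h : lat τ z) : lat τ (-z) := by
  obtain ⟨m, n, rfl⟩ := h
  exact ⟨-m, -n, by push_cast; ring⟩

lemma lat_add {τ z : ℂ} (a b : ℤ) (h : lat τ z) : lat τ (z + (a + b * τ)) := by
  obtain ⟨m, n, rfl⟩ := h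
  exact ⟨m + a, n + b, by push_cast; ring⟩

lemma not_lat_add {τ z : ℂ} (a b : ℤ) (h : ¬ lat τ z) : ¬ lat τ (z + (a + b * τ)) := by
  intro h'
  apply h
  have := lat_add (-a) (-b) h'
  convert this using 1
  push_cast; ring

lemma not_lat_neg {τ z : ℂ} (h : ¬ lat τ z) : ¬ lat τ (-z) := by
  intro h'
  apply h
  simpa using lat_neg h'

lemma adm_omz_zero {τ : ℂ} (hτ : 0 < τ.im) : Adm omz τ 0 := by
  refine ⟨hτ, fun n => ?_, fun n hn => ?_⟩
  · unfold omz; split_ifs <;> simp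
  · have hn0 : n ≠ 0 := by rintro rfl; simp [omz] at hn
    apply np_of_im
    have : (n : ℝ) ≠ 0 := by exact_mod_cast hn0
    simp [this, hτ.ne']

/-- the main function `ζ - η₁ z` as a cotangent series -/
abbrev LL (τ z : ℂ) : ℂ := Lw one' τ z

lemma fn_neg (t z : ℂ) (n : ℤ) : fn t (-z) n = - fn t z (-n) := by
  have : -z - n * t = -(z - ((-n : ℤ) : ℂ) * t) := by push_cast; ring
  rw [fn, fn, this, gc_neg, Int.sign_neg]
  push_cast; ring

lemma Lw_neg (a : ℤ → ℂ) (ha : ∀ n, a (-n) = a n) (t z : ℂ) : Lw a t (-z) = - Lw a t z := by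
  unfold Lw
  rw [← tsum_neg, ← (Equiv.neg ℤ).tsum_eq]
  congr 1; ext n
  simp [fn_neg, ha]

lemma Dw_neg (a : ℤ → ℂ) (ha : ∀ n, a (-n) = a n) (t z : ℂ) : Dw a t (-z) = Dw a t z := by
  unfold Dw
  rw [← (Equiv.neg ℤ).tsum_eq]
  congr 1; ext n
  have : -z - ((-n : ℤ) : ℂ) * t = -(z - n * t) := by push_cast; ring
  simp only [Equiv.neg_apply, this, gd_neg, ha]

lemma Tw_neg (a : ℤ → ℂ) (ha : ∀ n, a (-n) = a n) (t z : ℂ) : Tw a t (-z) = - Tw a t z := by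
  unfold Tw
  rw [← tsum_neg, ← (Equiv.neg ℤ).tsum_eq]
  congr 1; ext n
  have : -z - ((-n : ℤ) : ℂ) * t = -(z - n * t) := by push_cast; ring
  simp only [Equiv.neg_apply, this, gd_neg, ha]
  push_cast; ring

lemma one_even (n : ℤ) : one' (-n) = one' n := rfl
lemma omz_even (n : ℤ) : omz (-n) = omz n := by simp [omz]

lemma fn_add_one (t z : ℂ) (n : ℤ) : fn t (z + 1) n = fn t z n := by
  have : z + 1 - n * t = (z - n * t) + 1 := by ring
  rw [fn, this, gc_add_one, fn]

lemma Lw_add_one (a : ℤ → ℂ) (t z : ℂ) : Lw a t (z + 1) = Lw a t z := by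
  simp only [Lw, fn_add_one]

lemma Dw_add_one (a : ℤ → ℂ) (t z : ℂ) : Dw a t (z + 1) = Dw a t z := by
  unfold Dw
  congr 1; ext n
  have : z + 1 - n * t = (z - n * t) + 1 := by ring
  rw [this, gd_add_one]

lemma Tw_add_one (a : ℤ → ℂ) (t z : ℂ) : Tw a t (z + 1) = Tw a t z := by
  unfold Tw
  congr 1; ext n
  have : z + 1 - n * t = (z - n * t) + 1 := by ring
  rw [this, gd_add_one]

lemma Dw_add_tau (τ z : ℂ) : Dw one' τ (z + τ) = Dw one' τ z := by
  unfold Dw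
  rw [← (Equiv.addRight (1 : ℤ)).tsum_eq]
  congr 1; ext n
  have : z + τ - ((n + 1 : ℤ) : ℂ) * τ = z - n * τ := by push_cast; ring
  simp only [Equiv.coe_addRight, this, one']

lemma Tw_add_tau {τ z : ℂ} (h : Adm one' τ z) :
    Tw one' τ (z + τ) = Tw one' τ z - Dw one' τ z := by
  unfold Tw Dw
  rw [← (Equiv.addRight (1 : ℤ)).tsum_eq, ← h.facts.2.2.1.tsum_sub h.facts.2.1]
  congr 1; ext n
  have : z + τ - ((n + 1 : ℤ) : ℂ) * τ = z - n * τ := by push_cast; ring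
  simp only [Equiv.coe_addRight, this, one']
  push_cast; ring

lemma LL_add_tau {τ z : ℂ} (h : Adm one' τ z) (h' : Adm one' τ (z + τ)) :
    LL τ (z + τ) = LL τ z - 2 * Real.pi * I := by
  have s1 := h.facts.1
  have s2 := h'.facts.1
  have s3 := (s2.sub s1).hasSum
  rw [s2.tsum_sub s1] at s3
  set h' : ℤ → ℂ := fun n => gc (z - n * τ) with hh
  have e : ∀ n : ℤ, one' n * fn τ (z + τ) n - one' n * fn τ z n = h' (n - 1) - h' n := by
    intro n
    have : z + τ - n * τ = z - ((n - 1 : ℤ) : ℂ) * τ := by push_cast; ring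
    simp only [one', fn, hh, this]
    ring
  simp only [e] at s3
  have s4 := s3.nat_add_neg_add_one.tendsto_sum_nat
  have e2 : ∀ N : ℕ, ∑ n ∈ Finset.range N, (h' ((n : ℤ) - 1) - h' n + (h' (-((n : ℤ) + 1) - 1) - h' (-((n : ℤ) + 1))))
      = h' (-(N : ℤ) - 1) - h' ((N : ℤ) - 1) := by
    intro N
    induction N with
    | zero => simp
    | succ k ih =>
      rw [Finset.sum_range_succ, ih]
      have e3 : ((k + 1 : ℕ) : ℤ) - 1 = k := by push_cast; ring
      have e4 : -((k + 1 : ℕ) : ℤ) - 1 = -((k : ℤ) + 1) - 1 := by push_cast; ring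
      have e5 : -((k : ℤ) + 1) = -(k : ℤ) - 1 := by ring
      rw [e3, e4, e5]
      ring
  simp only [e2] at s4
  have hc := s1.tendsto_cofinite_zero
  have l1 : Tendsto (fun N : ℕ => h' ((N : ℤ) - 1)) atTop (𝓝 (Real.pi * I)) := by
    have inj : Function.Injective (fun N : ℕ => (N : ℤ) - 1) := by
      intro a b hab; simpa using hab
    have t1 := hc.comp (inj.tendsto_cofinite)
    rw [Nat.cofinite_eq_atTop] at t1
    have t2 := t1.add_const (Real.pi * I)
    rw [zero_add] at t2
    refine t2.congr' ?_
    filter_upwards [eventually_ge_atTop 2] with N hN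
    have : Int.sign ((N : ℤ) - 1) = 1 := Int.sign_eq_one_of_pos (by omega)
    simp only [Function.comp, one', fn, this, hh]
    push_cast; ring
  have l2 : Tendsto (fun N : ℕ => h' (-(N : ℤ) - 1)) atTop (𝓝 (-(Real.pi * I))) := by
    have inj : Function.Injective (fun N : ℕ => -(N : ℤ) - 1) := by
      intro a b hab; simpa using hab
    have t1 := hc.comp (inj.tendsto_cofinite)
    rw [Nat.cofinite_eq_atTop] at t1
    have t2 := t1.add_const (-(Real.pi * I))
    rw [zero_add] at t2
    refine t2.congr' ?_
    filter_upwards with N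
    have : Int.sign (-(N : ℤ) - 1) = -1 := Int.sign_eq_neg_one_of_neg (by omega)
    simp only [Function.comp, one', fn, this, hh]
    push_cast; ring
  have := tendsto_nhds_unique s4 (l2.sub l1)
  simp only [LL, Lw]
  linear_combination this

lemma symm_cot (w : ℂ) (hw : np w ∨ w = 0) :
    Tendsto (fun N : ℕ => 1 / w + ∑ j ∈ Finset.range N, (1 / (w - (j + 1)) + 1 / (w + (j + 1))))
      atTop (𝓝 (gc w)) := by
  rcases hw with hw | rfl
  · have hw' : w ∈ Complex.integerComplement := by
      rw [Complex.mem_integerComplement_iff]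
      rintro ⟨n, hn⟩
      exact (np_iff w).1 hw n hn.symm
    have := (tendsto_logDeriv_euler_cot_sub hw').const_add (1 / w)
    rw [show 1 / w + (Real.pi * Complex.cot (Real.pi * w) - 1 / w) = gc w by rw [gc]; ring] at this
    exact this
  · rw [gc_zero]
    have : ∀ j : ℕ, (1 / (0 - ((j : ℂ) + 1)) + 1 / (0 + ((j : ℂ) + 1))) = 0 := by
      intro j
      rw [zero_sub, zero_add, div_neg]; ring
    simp only [this, Finset.sum_const_zero, div_zero, add_zero]
    exact tendsto_const_nhds

lemma row_sum (w v : ℂ) (hw : np w ∨ w = 0) (hv : np v ∨ v = 0)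
    (hs : Summable fun m : ℤ => 1 / (w - m) - 1 / (v - m)) :
    ∑' m : ℤ, (1 / (w - m) - 1 / (v - m)) = gc w - gc v := by
  have h1 := hs.hasSum.nat_add_neg.tendsto_sum_nat
  have h2 := h1.comp (tendsto_add_atTop_nat 1)
  have h3 := ((symm_cot w hw).sub (symm_cot v hv)).add_const (1 / w - 1 / v)
  have h4 := tendsto_nhds_unique (h2.congr fun N => ?_) h3
  · simp only [Int.cast_zero, sub_zero] at h4
    linear_combination h4
  · simp only [Function.comp]
    rw [Finset.sum_range_succ']
    simp only [← Finset.sum_sub_distrib, Finset.sum_add_distrib]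
    push_cast
    simp only [sub_zero, neg_zero, sub_neg_eq_add, Finset.sum_sub_distrib, Finset.sum_add_distrib]
    ring

/-- the summand of the Weierstrass zeta function -/
def zt (τ z : ℂ) (p : ℤ × ℤ) : ℂ :=
  1 / (z - latPt τ p) + 1 / latPt τ p + z / (latPt τ p) ^ 2

lemma zt_summable {τ z : ℂ} (hτ : 0 < τ.im) : Summable (zt τ z) := by
  have hS := EisensteinSeries.summable_one_div_norm_rpow (k := 3) (by norm_num)
  set T : UpperHalfPlane := ⟨τ, hτ⟩ with hT
  have hr := EisensteinSeries.r_pos T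
  set r := EisensteinSeries.r T with hrd
  let e : (Fin 2 → ℤ) ≃ ℤ × ℤ := (finTwoArrowEquiv ℤ).trans (Equiv.prodComm ℤ ℤ)
  rw [← e.summable_iff]
  have hbig : ∀ᶠ x : Fin 2 → ℤ in cofinite, (2 * ‖z‖ + 1) / r ≤ ‖x‖ := by
    have := tendsto_norm_cocompact_atTop (E := Fin 2 → ℤ)
    rw [cocompact_eq_cofinite] at this
    exact this.eventually_ge_atTop _
  refine Summable.of_norm_bounded_eventually (hS.mul_left (2 * ‖z‖ ^ 2 * r ^ (-3 : ℝ))) ?_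
  filter_upwards [hbig] with x hx
  rw [div_le_iff₀ hr] at hx
  have hxz : x ≠ 0 := by
    rintro rfl
    rw [norm_zero, zero_mul] at hx
    linarith [norm_nonneg z]
  have hP : r * ‖x‖ ≤ ‖(x 0 : ℂ) * τ + x 1‖ := EisensteinSeries.r_mul_max_le T hxz
  have elp : latPt τ (e x) = (x 0 : ℂ) * τ + x 1 := by
    simp [latPt, e, finTwoArrowEquiv]; ring
  simp only [Function.comp, zt, elp]
  set P := (x 0 : ℂ) * τ + x 1 with hPd
  have hxp : 0 < ‖x‖ := norm_pos_iff.2 hxz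
  have hP0 : 0 < ‖P‖ := lt_of_lt_of_le (by positivity) hP
  have hPn : P ≠ 0 := norm_pos_iff.1 hP0
  have hzP : ‖P‖ / 2 ≤ ‖z - P‖ := by
    have := norm_sub_norm_le P z
    rw [norm_sub_rev] at this
    nlinarith
  have hzPn : z - P ≠ 0 := norm_pos_iff.1 (by linarith)
  have e1 : 1 / (z - P) + 1 / P + z / P ^ 2 = z ^ 2 / (P ^ 2 * (z - P)) := by
    field_simp; ring
  rw [e1, norm_div, norm_mul, norm_pow, norm_pow]
  have e2 : r ^ (-3 : ℝ) * ‖x‖ ^ (-3 : ℝ) = 1 / (r * ‖x‖) ^ 3 := by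
    rw [← Real.mul_rpow hr.le hxp.le, Real.rpow_neg (by positivity), one_div]
    norm_cast
  rw [mul_assoc, e2]
  calc ‖z‖ ^ 2 / (‖P‖ ^ 2 * ‖z - P‖) ≤ ‖z‖ ^ 2 / (‖P‖ ^ 2 * (‖P‖ / 2)) := by gcongr
    _ = 2 * ‖z‖ ^ 2 * (1 / ‖P‖ ^ 3) := by field_simp
    _ ≤ _ := by gcongr

lemma wzeta_eq_tsum {τ z : ℂ} (hτ : 0 < τ.im) : wzeta τ z = ∑' p, zt τ z p := by
  have h1 := (zt_summable (z := z) hτ).tsum_eq_add_tsum_ite 0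
  rw [h1, wzeta]
  have e0 : zt τ z 0 = 1 / z := by simp [zt, latPt]
  rw [e0]
  congr 1
  have h2 := tsum_subtype {p : ℤ × ℤ | p ≠ 0} (zt τ z)
  refine h2.trans ?_
  congr 1; ext p
  by_cases hp : p = 0 <;> simp [hp, Set.indicator]

/-- the constant `G₂`. -/
def GG (τ : ℂ) : ℂ := ∑' n : ℤ, ∑' m : ℤ, 1 / ((m : ℂ) + n * τ) ^ 2

lemma wzeta_eq_s7 {τ z : ℂ} (hτ : 0 < τ.im) (hz : ¬ lat τ z) :
    wzeta τ z = LL τ z + GG τ * z := by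
  have had := (adm_one_iff hτ).2 hz
  have hsum := zt_summable (z := z) hτ
  have hsw : Summable (fun p : ℤ × ℤ => zt τ z (p.2, p.1)) :=
    (Equiv.prodComm ℤ ℤ).summable_iff.2 hsum
  have htot : ∑' p, zt τ z p = ∑' n : ℤ, ∑' m : ℤ, zt τ z (m, n) := by
    rw [← (Equiv.prodComm ℤ ℤ).tsum_eq]
    exact hsw.tsum_prod
  have hrows : Summable fun n : ℤ => ∑' m : ℤ, zt τ z (m, n) := hsw.prod
  have hrow : ∀ n : ℤ, ∑' m : ℤ, zt τ z (m, n) =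
      (fn τ z n - omz n * fn τ 0 n) + z * ∑' m : ℤ, 1 / ((m : ℂ) + n * τ) ^ 2 := by
    intro n
    have f1 : Summable fun m : ℤ => zt τ z (m, n) := hsw.prod_factor n
    have f2 : Summable fun m : ℤ => 1 / ((m : ℂ) + n * τ) ^ 2 := by
      have := EisensteinSeries.linear_right_summable τ n (k := 2) le_rfl
      refine this.congr fun m => ?_
      rw [one_div, add_comm]; norm_cast
    have f3 := f2.mul_left z
    have f4 := f1.sub f3
    have e : ∀ m : ℤ, zt τ z (m, n) - z * (1 / ((m : ℂ) + n * τ) ^ 2) =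
        1 / ((z - n * τ) - m) - 1 / (-(n * τ) - m) := by
      intro m
      simp only [zt, latPt]
      rw [show z - ((m : ℂ) + n * τ) = (z - n * τ) - m by ring,
        show -((n : ℂ) * τ) - m = -((m : ℂ) + n * τ) by ring, div_neg]
      ring
    have e' := row_sum (z - n * τ) (-(n * τ)) (Or.inl (had.np n one_ne_zero)) (by
      by_cases hn : n = 0
      · right; simp [hn]
      · left
        have := (adm_omz_zero hτ).np n (by simp [omz, hn])
        simpa using this) (f4.congr e)
    have e2 : gc (z - n * τ) - gc (-(n * τ)) = fn τ z n - omz n * fn τ 0 n := by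
      by_cases hn : n = 0
      · simp [hn, omz, fn, gc_zero]
      · simp [hn, omz, fn]
    rw [← e2, ← e', ← tsum_mul_left, ← tsum_congr e, f1.tsum_sub f3]
    ring
  have s1 : Summable fun n : ℤ => fn τ z n := by simpa [one'] using had.facts.1
  have s2 := (adm_omz_zero hτ).facts.1
  have s3 : Summable fun n : ℤ => z * ∑' m : ℤ, 1 / ((m : ℂ) + n * τ) ^ 2 := by
    refine (hrows.sub (s1.sub s2)).congr fun n => ?_
    rw [hrow]; ring
  have hz0 : Lw omz τ 0 = 0 := by
    have := Lw_neg omz omz_even τ 0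
    rw [neg_zero] at this
    exact self_eq_neg.1 this
  rw [wzeta_eq_tsum hτ, htot, tsum_congr hrow, (s1.sub s2).tsum_add s3, s1.tsum_sub s2, tsum_mul_left]
  have : ∑' n : ℤ, omz n * fn τ 0 n = 0 := hz0
  rw [this]
  simp only [LL, Lw, one', one_mul, GG]
  ring

lemma half_not_lat {τ : ℂ} (hτ : 0 < τ.im) : ¬ lat τ (1 / 2) := by
  rintro ⟨m, n, h⟩
  have him := congrArg Complex.im h
  have hre := congrArg Complex.re h
  simp at him hre
  rcases him with h0 | h0
  · rw [h0] at hre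
    simp at hre
    have : (1 : ℝ) = 2 * m := by linarith
    have : (1 : ℤ) = 2 * m := by exact_mod_cast this
    omega
  · exact hτ.ne' h0

lemma eta1_eq {τ : ℂ} (hτ : 0 < τ.im) : eta1 τ = GG τ := by
  rw [eta1, wzeta_eq_s7 hτ (half_not_lat hτ), wzeta_eq_s7 hτ (not_lat_neg (half_not_lat hτ))]
  have := Lw_add_one one' τ (-(1 / 2))
  rw [show -(1 / 2 : ℂ) + 1 = 1 / 2 by norm_num] at this
  simp only [LL, this]
  ring

lemma zeta1_eq {τ z : ℂ} (hτ : 0 < τ.im) (hz : ¬ lat τ z) :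
    zeta1 τ z = (-i2pi)⁻¹ * LL τ z := by
  rw [zeta1, wzeta_eq_s7 hτ hz, eta1_eq hτ]; ring

lemma Adm.nhds {a : ℤ → ℂ} {τ z : ℂ} (h : Adm a τ z) : ∀ᶠ w in 𝓝 z, Adm a τ w :=
  h.facts.2.2.2.2.2.2.2.2

lemma Adm.anD {a : ℤ → ℂ} {τ z : ℂ} (h : Adm a τ z) : AnalyticAt ℂ (Dw a τ) z := by
  rw [Complex.analyticAt_iff_eventually_differentiableAt]
  filter_upwards [h.nhds] with w hw
  exact hw.facts.2.2.2.2.1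

lemma Adm.dL {a : ℤ → ℂ} {τ z : ℂ} (h : Adm a τ z) : HasDerivAt (Lw a τ) (Dw a τ z) z :=
  h.facts.2.2.2.1

lemma Adm.dT {a : ℤ → ℂ} {τ z : ℂ} (h : Adm a τ z) : DifferentiableAt ℂ (Tw a τ) z :=
  h.facts.2.2.2.2.2.1

/-- raw combination -/
def FR (τ z : ℂ) : ℂ :=
  4 * Real.pi * I * Tw one' τ z - (deriv (Dw one' τ) z + 2 * LL τ z * Dw one' τ z)

open Classical in
/-- truncated to vanish on the lattice -/
def FF (τ z : ℂ) : ℂ := if lat τ z then 0 else FR τ z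

lemma FF_eq {τ z : ℂ} (hz : ¬ lat τ z) : FF τ z = FR τ z := by simp [FF, hz]

lemma FR_diff {τ z : ℂ} (h : Adm one' τ z) : DifferentiableAt ℂ (FR τ) z := by
  have h1 := h.anD.deriv.differentiableAt
  have h2 := h.anD.differentiableAt
  have h3 : DifferentiableAt ℂ (LL τ) z := h.dL.differentiableAt
  have h4 := h.dT
  exact (h4.const_mul _).sub (h1.add ((h3.const_mul 2).mul h2))

lemma FF_diff {τ z : ℂ} (hτ : 0 < τ.im) (hz : ¬ lat τ z) : DifferentiableAt ℂ (FF τ) z := by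
  have h := (adm_one_iff hτ).2 hz
  refine (FR_diff h).congr_of_eventuallyEq ?_
  filter_upwards [h.nhds] with w hw
  exact FF_eq ((adm_one_iff hτ).1 hw)

lemma lat_one_iff (τ z : ℂ) : lat τ (z + 1) ↔ lat τ z := by
  constructor
  · intro h
    have := lat_add (-1) 0 h
    convert this using 1; push_cast; ring
  · intro h
    have := lat_add 1 0 h
    convert this using 1; push_cast; ring

lemma lat_tau_iff (τ z : ℂ) : lat τ (z + τ) ↔ lat τ z := by
  constructor
  · intro h
    have := lat_add 0 (-1) h
    convert this using 1; push_cast; ring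
  · intro h
    have := lat_add 0 1 h
    convert this using 1; push_cast; ring

lemma FF_one (τ : ℂ) : Function.Periodic (FF τ) 1 := by
  intro z
  have hd : deriv (Dw one' τ) (z + 1) = deriv (Dw one' τ) z := by
    rw [← deriv_comp_add_const]
    congr 1; ext w; exact Dw_add_one _ _ _
  by_cases h : lat τ z
  · simp [FF, h, lat_one_iff]
  · rw [FF_eq h, FF_eq (by rwa [lat_one_iff])]
    simp only [FR, LL, Tw_add_one, Lw_add_one, Dw_add_one, hd]

lemma FF_tau {τ : ℂ} (hτ : 0 < τ.im) : Function.Periodic (FF τ) τ := by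
  intro z
  have hd : deriv (Dw one' τ) (z + τ) = deriv (Dw one' τ) z := by
    rw [← deriv_comp_add_const]
    congr 1; ext w; exact Dw_add_tau _ _
  by_cases h : lat τ z
  · simp [FF, h, lat_tau_iff]
  · have h' : ¬ lat τ (z + τ) := by rwa [lat_tau_iff]
    rw [FF_eq h, FF_eq h']
    simp only [FR]
    rw [Tw_add_tau ((adm_one_iff hτ).2 h), LL_add_tau ((adm_one_iff hτ).2 h)
      ((adm_one_iff hτ).2 h'), Dw_add_tau, hd]
    ring

lemma FF_odd {τ z : ℂ} (hz : ¬ lat τ z) : FF τ (-z) = - FF τ z := by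
  have hd : deriv (Dw one' τ) (-z) = - deriv (Dw one' τ) z := by
    have h1 : deriv (fun w => Dw one' τ (-w)) z = - deriv (Dw one' τ) (-z) := deriv_comp_neg _ _
    have h2 : (fun w => Dw one' τ (-w)) = Dw one' τ := by
      ext w; exact Dw_neg _ one_even _ _
    rw [h2] at h1
    rw [h1, neg_neg]
  rw [FF_eq hz, FF_eq (not_lat_neg hz)]
  simp only [FR, LL, Lw_neg _ one_even, Dw_neg _ one_even, Tw_neg _ one_even, hd]
  ring

lemma np_punct : ∀ᶠ z : ℂ in 𝓝[≠] 0, np z := by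
  rw [eventually_nhdsWithin_iff]
  filter_upwards [ball_mem_nhds (0 : ℂ) one_pos] with z hz h0
  rw [np_iff]
  rintro k rfl
  rw [mem_ball_zero_iff, Complex.norm_intCast] at hz
  have : |k| < 1 := by exact_mod_cast hz
  rw [Int.abs_lt_one_iff] at this
  exact h0 (by simp [this])

lemma adm_of_np {τ z : ℂ} (h : Adm omz τ z) (hn : np z) : Adm one' τ z := by
  refine ⟨h.im, fun n => by simp [one'], fun n _ => ?_⟩
  by_cases h0 : n = 0
  · simpa [h0] using hn
  · exact h.np n (by simp [omz, h0])

lemma split_L {τ z : ℂ} (h : Adm omz τ z) : LL τ z = gc z + Lw omz τ z := by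
  have e : ∀ n : ℤ, one' n * fn τ z n = (if n = 0 then gc z else 0) + omz n * fn τ z n := by
    intro n
    by_cases h0 : n = 0 <;> simp [h0, one', omz, fn]
  simp only [LL, Lw, e]
  rw [Summable.tsum_add _ h.facts.1, tsum_ite_eq]
  exact (hasSum_ite_eq 0 (gc z)).summable

lemma split_D {τ z : ℂ} (h : Adm omz τ z) : Dw one' τ z = gd z + Dw omz τ z := by
  have e : ∀ n : ℤ, one' n * gd (z - n * τ) = (if n = 0 then gd z else 0) + omz n * gd (z - n * τ) := by
    intro n
    by_cases h0 : n = 0 <;> simp [h0, one', omz]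
  simp only [Dw, e]
  rw [Summable.tsum_add _ h.facts.2.1, tsum_ite_eq]
  exact (hasSum_ite_eq 0 (gd z)).summable

lemma split_T (τ z : ℂ) : Tw one' τ z = Tw omz τ z := by
  unfold Tw
  congr 1; ext n
  by_cases h0 : n = 0 <;> simp [h0, one', omz]

lemma split_D' {τ z : ℂ} (h : Adm omz τ z) (hn : np z) :
    deriv (Dw one' τ) z = -2 * gc z * gd z + deriv (Dw omz τ) z := by
  have e : Dw one' τ =ᶠ[𝓝 z] fun w => gd w + Dw omz τ w := by
    filter_upwards [h.nhds] with w hw using split_D hw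
  rw [e.deriv_eq]
  exact ((gd_hasDerivAt hn).add h.anD.differentiableAt.hasDerivAt).deriv

lemma z_gc : Tendsto (fun z : ℂ => z * gc z) (𝓝[≠] 0) (𝓝 1) := by
  have hpi : (Real.pi : ℂ) ≠ 0 := by exact_mod_cast Real.pi_ne_zero
  have hs : HasDerivAt (fun w : ℂ => Complex.sin (Real.pi * w)) (Real.pi : ℂ) 0 := by
    have := (Complex.hasDerivAt_sin (Real.pi * 0)).comp (0 : ℂ) ((hasDerivAt_id (0 : ℂ)).const_mul (Real.pi : ℂ))
    simpa [Function.comp_def] using this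
  have h1 := hs.tendsto_slope
  have h2 : Tendsto (fun w : ℂ => (Real.pi : ℂ) * Complex.cos (Real.pi * w)) (𝓝[≠] 0) (𝓝 (Real.pi : ℂ)) := by
    have : ContinuousAt (fun w : ℂ => (Real.pi : ℂ) * Complex.cos (Real.pi * w)) 0 := by fun_prop
    simpa using this.tendsto.mono_left nhdsWithin_le_nhds
  have h3 := h2.mul (h1.inv₀ hpi)
  rw [mul_inv_cancel₀ hpi] at h3
  refine h3.congr fun z => ?_
  simp only [slope, gc, Complex.cot, vsub_eq_sub, smul_eq_mul, mul_zero, Complex.sin_zero, sub_zero,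
    mul_inv, inv_inv]
  ring

lemma zFF {τ : ℂ} (hτ : 0 < τ.im) : Tendsto (fun z => z * FF τ z) (𝓝[≠] 0) (𝓝 0) := by
  have h := adm_omz_zero hτ
  have hid : Tendsto (fun z : ℂ => z) (𝓝[≠] 0) (𝓝 0) := tendsto_id.mono_left nhdsWithin_le_nhds
  have tT := h.dT.continuousAt.tendsto.mono_left (nhdsWithin_le_nhds (s := {0}ᶜ))
  have tD := h.anD.continuousAt.tendsto.mono_left (nhdsWithin_le_nhds (s := {0}ᶜ))
  have tD' := h.anD.deriv.continuousAt.tendsto.mono_left (nhdsWithin_le_nhds (s := {0}ᶜ))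
  have tL := h.dL.continuousAt.tendsto.mono_left (nhdsWithin_le_nhds (s := {0}ᶜ))
  have tS := h.dL.tendsto_slope
  have L0 : Lw omz τ 0 = 0 := by
    have := Lw_neg omz omz_even τ 0
    rw [neg_zero] at this
    exact self_eq_neg.mp this
  have tg : Tendsto (fun z : ℂ => -((Real.pi * z) ^ 2 + (z * gc z) ^ 2)) (𝓝[≠] 0) (𝓝 (-((Real.pi * 0) ^ 2 + 1 ^ 2))) :=
    (((hid.const_mul _).pow 2).add (z_gc.pow 2)).neg
  have big := ((((hid.mul tT).const_mul (4 * Real.pi * I)).sub (hid.mul tD')).sub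
    ((z_gc.mul tD).const_mul 2)).sub ((tS.mul tg).const_mul 2) |>.sub (((hid.mul tL).mul tD).const_mul 2)
  have e0 : 4 * (Real.pi : ℂ) * I * (0 * Tw omz τ 0) - 0 * deriv (Dw omz τ) 0 - 2 * (1 * Dw omz τ 0) -
      2 * (Dw omz τ 0 * -((Real.pi * 0) ^ 2 + 1 ^ 2)) - 2 * (0 * Lw omz τ 0 * Dw omz τ 0) = 0 := by ring
  rw [e0] at big
  refine big.congr' ?_
  filter_upwards [np_punct, h.nhds.filter_mono nhdsWithin_le_nhds, self_mem_nhdsWithin] with z hn ha hz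
  have hz0 : z ≠ 0 := hz
  rw [FF_eq ((adm_one_iff hτ).1 (adm_of_np ha hn))]
  simp only [FR, split_L ha, split_D ha, split_T, split_D' ha hn, slope, L0, vsub_eq_sub, smul_eq_mul,
    sub_zero]
  have : z⁻¹ * Lw omz τ z * -((Real.pi * z) ^ 2 + (z * gc z) ^ 2) = z * Lw omz τ z * gd z := by
    unfold gd; field_simp
  rw [this]
  ring

lemma off_lat_punct {τ : ℂ} (hτ : 0 < τ.im) : ∀ᶠ z in 𝓝[≠] 0, ¬ lat τ z := by
  filter_upwards [np_punct, (adm_omz_zero hτ).nhds.filter_mono nhdsWithin_le_nhds] with z hn ha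
  exact (adm_one_iff hτ).1 (adm_of_np ha hn)

/-- entire extension -/
def Fh (τ z : ℂ) : ℂ := limUnder (𝓝[≠] z) (FF τ)

lemma Fh_eq {τ z : ℂ} (hτ : 0 < τ.im) (hz : ¬ lat τ z) : Fh τ z = FF τ z :=
  ((FF_diff hτ hz).continuousAt.tendsto.mono_left nhdsWithin_le_nhds).limUnder_eq

lemma Fh_per {τ c : ℂ} (h : Function.Periodic (FF τ) c) : Function.Periodic (Fh τ) c := by
  intro z
  unfold Fh limUnder
  have e : 𝓝[≠] (z + c) = Filter.map (fun w => w + c) (𝓝[≠] z) := by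
    have := (Homeomorph.addRight c).isEmbedding.map_nhdsWithin_eq {z}ᶜ z
    simp only [Homeomorph.coe_addRight] at this
    rw [this]
    congr 1
    ext w
    simp [← sub_eq_add_neg, sub_eq_iff_eq_add]
  rw [e, Filter.map_map]
  congr 2
  ext w
  exact h w

lemma Fh_diff0 {τ : ℂ} (hτ : 0 < τ.im) : DifferentiableAt ℂ (Fh τ) 0 := by
  have hp := off_lat_punct hτ
  rw [eventually_nhdsWithin_iff] at hp
  set s : Set ℂ := {z | z ∈ ({0}ᶜ : Set ℂ) → ¬ lat τ z} with hs
  have hs' : s ∈ 𝓝 (0 : ℂ) := hp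
  have key := Complex.differentiableOn_update_limUnder_of_isLittleO (f := FF τ) hs' (by
    rintro z ⟨hz, hz0⟩
    exact (FF_diff hτ (hz hz0)).differentiableWithinAt) (by
    rw [Asymptotics.isLittleO_iff_tendsto']
    · have h1 := zFF hτ
      have h2 : Tendsto (fun z : ℂ => z * FF τ 0) (𝓝[≠] 0) (𝓝 0) := by
        have : ContinuousAt (fun z : ℂ => z * FF τ 0) 0 := by fun_prop
        simpa using this.tendsto.mono_left nhdsWithin_le_nhds
      have h3 := h1.sub h2
      rw [sub_zero] at h3
      refine h3.congr fun z => ?_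
      simp only [sub_zero, div_inv_eq_mul]
      ring
    · filter_upwards [self_mem_nhdsWithin] with z hz h
      simp at h
      exact absurd h hz)
  refine (key.differentiableAt hs').congr_of_eventuallyEq ?_
  filter_upwards [hs'] with z hz
  by_cases h0 : z = 0
  · subst h0; simp [Fh]
  · rw [Function.update_of_ne h0]
    exact Fh_eq hτ (hz h0)

lemma Fh_lat {τ : ℂ} (hτ : 0 < τ.im) (m n : ℤ) : Function.Periodic (Fh τ) (m + n * τ) := by
  have h1 := (Fh_per (FF_one τ)).int_mul m
  have h2 := (Fh_per (FF_tau hτ)).int_mul n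
  rw [mul_one] at h1
  exact h1.add_period h2

lemma Fh_diff {τ : ℂ} (hτ : 0 < τ.im) : Differentiable ℂ (Fh τ) := by
  intro z
  by_cases hz : lat τ z
  · obtain ⟨m, n, rfl⟩ := hz
    have e : Fh τ = fun w => Fh τ (w - (m + n * τ)) := by
      ext w
      exact ((Fh_lat hτ m n).sub_eq w).symm
    rw [e]
    have := Fh_diff0 hτ
    rw [← sub_self ((m : ℂ) + n * τ)] at this
    exact DifferentiableAt.comp (g := Fh τ) (f := fun w => w - (m + n * τ)) _ this (by fun_prop)
  · have h := (adm_one_iff hτ).2 hz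
    refine (FF_diff hτ hz).congr_of_eventuallyEq ?_
    filter_upwards [h.nhds] with w hw
    exact Fh_eq hτ ((adm_one_iff hτ).1 hw)

lemma Fh_bdd {τ : ℂ} (hτ : 0 < τ.im) : Bornology.IsBounded (Set.range (Fh τ)) := by
  set K : Set ℂ := (fun p : ℝ × ℝ => Fh τ ((p.1 : ℂ) + p.2 * τ)) '' (Set.Icc 0 1 ×ˢ Set.Icc 0 1) with hK
  have hc : IsCompact K := by
    refine (isCompact_Icc.prod isCompact_Icc).image ?_
    exact (Fh_diff hτ).continuous.comp (by fun_prop)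
  refine hc.isBounded.subset ?_
  rintro _ ⟨z, rfl⟩
  set b : ℝ := z.im / τ.im with hb
  set a : ℝ := z.re - b * τ.re with ha
  have hz : z = (a : ℂ) + b * τ := by
    apply Complex.ext
    · simp [ha]
    · simp [hb, hτ.ne']
  refine ⟨(Int.fract a, Int.fract b), ⟨⟨Int.fract_nonneg _, (Int.fract_lt_one _).le⟩,
    ⟨Int.fract_nonneg _, (Int.fract_lt_one _).le⟩⟩, ?_⟩
  have e : z = ((Int.fract a : ℝ) : ℂ) + (Int.fract b : ℝ) * τ + ((⌊a⌋ : ℂ) + (⌊b⌋ : ℂ) * τ) := by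
    conv_lhs => rw [hz, ← Int.fract_add_floor a, ← Int.fract_add_floor b]
    push_cast; ring
  rw [e]
  exact (Fh_lat hτ ⌊a⌋ ⌊b⌋ _).symm

lemma FR_zero {τ z : ℂ} (hτ : 0 < τ.im) (hz : ¬ lat τ z) : FR τ z = 0 := by
  have h := (Fh_diff hτ).apply_eq_apply_of_bounded (Fh_bdd hτ) (-z) z
  rw [Fh_eq hτ hz, Fh_eq hτ (not_lat_neg hz), FF_odd hz] at h
  rw [← FF_eq hz]
  exact self_eq_neg.mp h.symm

/-- `∂_τ ζ₁ + ζ₁ ∂_z ζ₁ = (2πi)⁻² ℘'/2`. -/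
theorem heat_identity_zeta1 (τ : ℂ) (hτ : 0 < τ.im) (z : ℂ) (hz : ¬ lat τ z) :
    deriv (fun t => zeta1 t z) τ + zeta1 τ z * deriv (zeta1 τ) z
      = (i2pi ^ 2)⁻¹ * (1 / 2) * deriv (wp τ) z := by
  have h := (adm_one_iff hτ).2 hz
  have d1 : deriv (fun t => zeta1 t z) τ = (-i2pi)⁻¹ * Tw one' τ z := by
    have e : (fun t => zeta1 t z) =ᶠ[𝓝 τ] fun t => (-i2pi)⁻¹ * Lw one' t z := by
      filter_upwards [h.facts.2.2.2.2.2.2.2.1] with t ht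
      exact zeta1_eq ht.im ((adm_one_iff ht.im).1 ht)
    rw [e.deriv_eq]
    exact (h.facts.2.2.2.2.2.2.1.const_mul _).deriv
  have d2 : deriv (zeta1 τ) z = (-i2pi)⁻¹ * Dw one' τ z := by
    have e : zeta1 τ =ᶠ[𝓝 z] fun w => (-i2pi)⁻¹ * Lw one' τ w := by
      filter_upwards [h.nhds] with w hw
      exact zeta1_eq hτ ((adm_one_iff hτ).1 hw)
    rw [e.deriv_eq]
    exact (h.dL.const_mul _).deriv
  have d3 : deriv (wp τ) z = - deriv (Dw one' τ) z := by
    have e1 : ∀ w, Adm one' τ w → wp τ w = -(Dw one' τ w + GG τ) := by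
      intro w hw
      have e : wzeta τ =ᶠ[𝓝 w] fun v => Lw one' τ v + GG τ * v := by
        filter_upwards [hw.nhds] with v hv
        exact wzeta_eq_s7 hτ ((adm_one_iff hτ).1 hv)
      rw [wp, e.deriv_eq]
      congr 1
      have := hw.dL.add ((hasDerivAt_id w).const_mul (GG τ))
      rw [mul_one] at this
      exact this.deriv
    have e : wp τ =ᶠ[𝓝 z] fun w => -(Dw one' τ w + GG τ) := by
      filter_upwards [h.nhds] with w hw using e1 w hw
    rw [e.deriv_eq]
    exact (h.anD.differentiableAt.hasDerivAt.add_const (GG τ)).neg.deriv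
  have key := FR_zero hτ hz
  rw [d1, d2, d3, zeta1_eq hτ hz]
  unfold FR at key
  have hi : i2pi ≠ 0 := by
    unfold i2pi
    simp [Real.pi_ne_zero]
  have e4 : 4 * (Real.pi : ℂ) * I = 2 * i2pi := by unfold i2pi; ring
  rw [e4] at key
  have hD : deriv (Dw one' τ) z = 2 * i2pi * Tw one' τ z - 2 * LL τ z * Dw one' τ z := by
    linear_combination -key
  rw [hD]
  field_simp
  ring
end
end
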